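/- Let a be a complex number that is not an integer with Re(a) < 0. Then Σ_{k=0}^∞ [(a)_k (-1)^k / k!] · [ψ(1+k) - ψ(a+k)] = π cot(πa) · 2^{-a} + (1/(1-a)) · Σ_{k=0}^∞ (-1)^k k! / (2-a)_k, where 2^{-a} = exp(-a log 2). Both series converge. -/

import Mathlib

open Complex Finset

noncomputable def ψ (z : ℂ) : ℂ := deriv Complex.Gamma z / Complex.Gamma z

noncomputable def rf (x : ℂ) (n : ℕ) : ℂ := ∏ j ∈ Finset.range n, (x + j)

theorem hasDerivAt_tsum_mul_pow {u : ℕ → ℂ} {B : ℝ} (hu : ∀ k, ‖u k‖ ≤ B) {x : ℝ}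
    (hx : |x| < 1) :
    HasDerivAt (fun t : ℝ => ∑' k, u k * (t : ℂ) ^ k)
      (∑' k : ℕ, ((k : ℂ) + 1) * u (k + 1) * (x : ℂ) ^ k) x := by
  obtain ⟨r, hr, hr1⟩ := exists_between hx
  have hr0 : 0 < r := (abs_nonneg x).trans_lt hr
  have key : HasDerivAt (fun t : ℝ => ∑' k, u k * (t : ℂ) ^ k)
      (∑' k : ℕ, u k * (k * (x : ℂ) ^ (k - 1))) x := by
    have hs : Summable fun k : ℕ => B * ((k : ℝ) * r ^ (k - 1)) := by
      refine Summable.mul_left _ ?_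
      rw [← summable_nat_add_iff 1]
      have h1 := summable_pow_mul_geometric_of_norm_lt_one 1 (r := r) (by
        rwa [Real.norm_of_nonneg hr0.le])
      have h2 := summable_geometric_of_lt_one hr0.le hr1
      refine (h1.add h2).congr fun k => ?_
      push_cast
      simp
      ring
    refine hasDerivAt_tsum_of_isPreconnected (t := Metric.ball (0 : ℝ) r) (y₀ := 0)
      (g := fun (k : ℕ) (t : ℝ) => u k * (t : ℂ) ^ k) (g' := fun (k : ℕ) (t : ℝ) => u k * (k * (t : ℂ) ^ (k - 1))) hs
      Metric.isOpen_ball (convex_ball (0 : ℝ) r).isPreconnected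
      (fun n y _ => ?_) (fun n y hy => ?_) (Metric.mem_ball_self hr0) ?_ (by simpa using hr)
    · simpa using ((Complex.ofRealCLM.hasDerivAt (x := y)).pow n).const_mul (u n)
    · have hy' : |y| ≤ r := by simpa using (Metric.mem_ball.1 hy).le
      rw [norm_mul, norm_mul, norm_pow, Complex.norm_natCast, Complex.norm_real, Real.norm_eq_abs]
      gcongr
      exact (norm_nonneg _).trans (hu 0)
      exact hu n
    · refine summable_of_ne_finset_zero (s := {0}) fun b hb => ?_
      simp only [Finset.mem_singleton] at hb
      simp [hb]
  refine key.congr_deriv ?_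
  rw [tsum_eq_zero_add' (f := fun k : ℕ => u k * (k * (x : ℂ) ^ (k - 1)))]
  · rw [Nat.cast_zero, zero_mul, mul_zero, zero_add]
    refine tsum_congr fun k => ?_
    push_cast
    ring
  · have h1 := summable_pow_mul_geometric_of_norm_lt_one 1 (r := |x|) (by simpa using hx)
    have h2 := summable_geometric_of_lt_one (abs_nonneg x) hx
    refine Summable.of_norm_bounded ((h1.add h2).mul_left B) fun k => ?_
    rw [norm_mul, norm_mul, norm_pow, Complex.norm_natCast, Complex.norm_real, Real.norm_eq_abs]
    push_cast
    rw [pow_one, ← add_one_mul]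
    gcongr
    exact hu _

theorem summable_mul_pow {u : ℕ → ℂ} {B : ℝ} (hu : ∀ k, ‖u k‖ ≤ B) {x : ℝ} (hx : |x| < 1) :
    Summable fun k => u k * (x : ℂ) ^ k := by
  refine Summable.of_norm_bounded
    ((summable_geometric_of_lt_one (abs_nonneg x) hx).mul_left B) fun k => ?_
  rw [norm_mul, norm_pow, Complex.norm_real, Real.norm_eq_abs]
  gcongr
  exact hu k

theorem summable_natCast_mul_mul_pow {u : ℕ → ℂ} {B : ℝ} (hu : ∀ k, ‖u k‖ ≤ B) {x : ℝ}
    (hx : |x| < 1) : Summable fun k : ℕ => (k : ℂ) * u k * (x : ℂ) ^ k := by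
  have h1 := summable_pow_mul_geometric_of_norm_lt_one 1 (r := |x|) (by simpa using hx)
  refine Summable.of_norm_bounded (h1.mul_left B) fun k => ?_
  rw [norm_mul, norm_mul, norm_pow, Complex.norm_natCast, Complex.norm_real, Real.norm_eq_abs,
    pow_one, mul_comm (k : ℝ), mul_assoc]
  gcongr
  exact hu k

theorem mul_tsum_succ_mul_pow {u : ℕ → ℂ} {B : ℝ} (hu : ∀ k, ‖u k‖ ≤ B) {x : ℝ}
    (hx : |x| < 1) :
    (x : ℂ) * ∑' k : ℕ, ((k : ℂ) + 1) * u (k + 1) * (x : ℂ) ^ k =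
      ∑' k : ℕ, (k : ℂ) * u k * (x : ℂ) ^ k := by
  rw [(summable_natCast_mul_mul_pow hu hx).tsum_eq_zero_add, ← tsum_mul_left]
  simp only [Nat.cast_zero, zero_mul, zero_add]
  refine tsum_congr fun k => ?_
  push_cast
  ring

theorem continuousOn_tsum_mul_pow {u : ℕ → ℂ} (hu : Summable fun k => ‖u k‖) :
    ContinuousOn (fun t : ℝ => ∑' k, u k * (t : ℂ) ^ k) (Set.Icc 0 1) := by
  refine continuousOn_tsum (fun k => by fun_prop) hu fun k t ht => ?_
  rw [norm_mul, norm_pow, Complex.norm_real, Real.norm_of_nonneg ht.1]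
  exact mul_le_of_le_one_right (norm_nonneg _) (pow_le_one₀ ht.1 ht.2)

theorem eq_of_hasDerivAt_zero {h : ℝ → ℂ} (hc : ContinuousOn h (Set.Ioc 0 1))
    (hd : ∀ x ∈ Set.Ioo (0 : ℝ) 1, HasDerivAt h 0 x) {x : ℝ} (hx : x ∈ Set.Ioc (0 : ℝ) 1) :
    h x = h 1 := by
  refine (constant_of_has_deriv_right_zero (a := x) (b := 1)
    (hc.mono fun y hy => ⟨hx.1.trans_le hy.1, hy.2⟩)
    (fun y hy => (hd y ⟨hx.1.trans_le hy.1, hy.2⟩).hasDerivWithinAt) 1 ⟨hx.2, le_rfl⟩).symm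

theorem norm_add_natCast_add_one_ge {s : ℂ} (hs : -(1 / 2) < s.re) (m : ℕ) :
    ((m : ℝ) + 1) / 2 ≤ ‖(m : ℂ) + 1 + s‖ := by
  refine le_trans ?_ (Complex.re_le_norm _)
  have : (0 : ℝ) ≤ m := m.cast_nonneg
  simp
  linarith

theorem add_natCast_add_one_ne_zero {s : ℂ} (hs : -(1 / 2) < s.re) (m : ℕ) :
    (m : ℂ) + 1 + s ≠ 0 := by
  intro h
  have := norm_add_natCast_add_one_ge hs m
  rw [h, norm_zero] at this
  have : (0 : ℝ) ≤ m := m.cast_nonneg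
  linarith

theorem norm_inv_sub_inv_le {s : ℂ} (hs : -(1 / 2) < s.re) (m : ℕ) :
    ‖((m : ℂ) + 1 + s)⁻¹ - ((m : ℂ) + 1)⁻¹‖ ≤ 2 * ‖s‖ * (1 / ((m : ℝ) + 1) ^ 2) := by
  have h1 := add_natCast_add_one_ne_zero hs m
  have h2 : (m : ℂ) + 1 ≠ 0 := Nat.cast_add_one_ne_zero m
  have h3 : ‖(m : ℂ) + 1‖ = (m : ℝ) + 1 := by exact_mod_cast Complex.norm_natCast (m + 1)
  rw [inv_sub_inv h1 h2, sub_add_cancel_left, norm_div, norm_neg, norm_mul, h3]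
  have h4 := norm_add_natCast_add_one_ge hs m
  have h5 : (0 : ℝ) < (m : ℝ) + 1 := by positivity
  rw [div_le_iff₀ (mul_pos (by linarith) h5)]
  calc ‖s‖ = 2 * ‖s‖ * (1 / ((m : ℝ) + 1) ^ 2) * ((((m : ℝ) + 1) / 2) * (m + 1)) := by
        field_simp
    _ ≤ _ := by gcongr

theorem summable_one_div_natCast_add_one_sq : Summable fun m : ℕ => 1 / ((m : ℝ) + 1) ^ 2 := by
  have := (summable_nat_add_iff 1).2 (Real.summable_one_div_nat_pow.2 one_lt_two)
  exact this.congr fun m => by push_cast; rfl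

theorem summable_inv_sub_inv {s : ℂ} (hs : -(1 / 2) < s.re) :
    Summable fun m : ℕ => ((m : ℂ) + 1 + s)⁻¹ - ((m : ℂ) + 1)⁻¹ :=
  Summable.of_norm_bounded (summable_one_div_natCast_add_one_sq.mul_left _)
    (norm_inv_sub_inv_le hs)

theorem hasDerivAt_log_one_add_div {s : ℂ} (hs : -(1 / 2) < s.re) (m : ℕ) :
    HasDerivAt (fun z : ℂ => Complex.log (1 + z / (m + 1)) - z / (m + 1))
      (((m : ℂ) + 1 + s)⁻¹ - ((m : ℂ) + 1)⁻¹) s := by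
  have h2 : (m : ℂ) + 1 ≠ 0 := Nat.cast_add_one_ne_zero m
  have h1 := add_natCast_add_one_ne_zero hs m
  have hslit : 1 + s / (m + 1) ∈ Complex.slitPlane := by
    left
    have : (s / ((m : ℂ) + 1)).re = s.re / (m + 1) := by
      exact_mod_cast Complex.div_natCast_re s (m + 1)
    rw [Complex.add_re, Complex.one_re, this]
    have h5 : (1 : ℝ) ≤ (m : ℝ) + 1 := by simp
    have : -1 < s.re / (m + 1) := by
      rw [lt_div_iff₀ (by linarith)]
      linarith
    linarith
  have hd : HasDerivAt (fun z : ℂ => z / (m + 1)) (1 / ((m : ℂ) + 1)) s :=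
    (hasDerivAt_id s).div_const _
  refine (((hd.const_add 1).clog hslit).sub hd).congr_deriv ?_
  have h3 : 1 + s / ((m : ℂ) + 1) ≠ 0 := Complex.slitPlane_ne_zero hslit
  have : (m : ℂ) + 1 + s = (m + 1) * (1 + s / (m + 1)) := by field_simp
  rw [this]
  field_simp

theorem summable_and_hasDerivAt_log_series {s : ℂ} (hs : -(1 / 2) < s.re) :
    Summable (fun m : ℕ => Complex.log (1 + s / (m + 1)) - s / (m + 1)) ∧
    HasDerivAt (fun z : ℂ => ∑' m : ℕ, (Complex.log (1 + z / (m + 1)) - z / (m + 1)))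
      (∑' m : ℕ, (((m : ℂ) + 1 + s)⁻¹ - ((m : ℂ) + 1)⁻¹)) s := by
  have hu := summable_one_div_natCast_add_one_sq.mul_left (2 * (‖s‖ + 1))
  let t : Set ℂ := {z | -(1 / 2) < z.re} ∩ Metric.ball 0 (‖s‖ + 1)
  have ht : IsOpen t :=
    (isOpen_lt continuous_const Complex.continuous_re).inter Metric.isOpen_ball
  have ht' : IsPreconnected t :=
    ((convex_halfSpace_re_gt _).inter (convex_ball _ _)).isPreconnected
  have h0 : (0 : ℂ) ∈ t := ⟨by simp, by simp; positivity⟩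
  have hst : s ∈ t := ⟨hs, by simp⟩
  have hb : ∀ (m : ℕ) (z : ℂ), z ∈ t → ‖((m : ℂ) + 1 + z)⁻¹ - ((m : ℂ) + 1)⁻¹‖ ≤
      2 * (‖s‖ + 1) * (1 / ((m : ℝ) + 1) ^ 2) := fun m z hz => by
    refine (norm_inv_sub_inv_le hz.1 m).trans ?_
    have : ‖z‖ ≤ ‖s‖ + 1 := by simpa using (Metric.mem_ball.1 hz.2).le
    gcongr
  have hd : ∀ (m : ℕ) (z : ℂ), z ∈ t →
      HasDerivAt (fun z : ℂ => Complex.log (1 + z / (m + 1)) - z / (m + 1))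
      (((m : ℂ) + 1 + z)⁻¹ - ((m : ℂ) + 1)⁻¹) z :=
    fun m z hz => hasDerivAt_log_one_add_div hz.1 m
  have hs0 : Summable fun m : ℕ =>
      Complex.log (1 + (0 : ℂ) / ((m : ℂ) + 1)) - (0 : ℂ) / ((m : ℂ) + 1) := by
    simp [summable_zero]
  clear_value t
  constructor
  · exact summable_of_summable_hasDerivAt_of_isPreconnected
      (g := fun (m : ℕ) (z : ℂ) => Complex.log (1 + z / (m + 1)) - z / (m + 1))
      (g' := fun (m : ℕ) (z : ℂ) => ((m : ℂ) + 1 + z)⁻¹ - ((m : ℂ) + 1)⁻¹)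
      hu ht ht' hd hb h0 hs0 hst
  · exact hasDerivAt_tsum_of_isPreconnected
      (g := fun (m : ℕ) (z : ℂ) => Complex.log (1 + z / (m + 1)) - z / (m + 1))
      (g' := fun (m : ℕ) (z : ℂ) => ((m : ℂ) + 1 + z)⁻¹ - ((m : ℂ) + 1)⁻¹)
      hu ht ht' hd hb h0 hs0 hst

theorem Gamma_one_add_eq_exp {s : ℂ} (hs : 0 < s.re) :
    Complex.Gamma (1 + s) = Complex.exp (-(Real.eulerMascheroniConstant * s) -
      ∑' m : ℕ, (Complex.log (1 + s / (m + 1)) - s / (m + 1))) := by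
  have hs' : -(1 / 2) < s.re := by linarith
  have hs0 : s ≠ 0 := by rintro rfl; simp at hs
  have hL := (summable_and_hasDerivAt_log_series hs').1.hasSum.tendsto_sum_nat
  have hH : Filter.Tendsto (fun n : ℕ => (((harmonic n : ℝ) - Real.log n : ℝ) : ℂ))
      Filter.atTop (nhds (Real.eulerMascheroniConstant : ℂ)) :=
    (Complex.continuous_ofReal.tendsto _).comp Real.tendsto_harmonic_sub_log
  have hR := (((hH.mul_const s).neg.sub hL).cexp)
  have hG := (Complex.GammaSeq_tendsto_Gamma s).const_mul s
  rw [← Complex.Gamma_add_one s hs0, add_comm s 1] at hG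
  refine tendsto_nhds_unique (hG.congr' ?_) hR
  filter_upwards [Filter.eventually_gt_atTop 0] with n hn
  have hn0 : (n : ℂ) ≠ 0 := Nat.cast_ne_zero.2 hn.ne'
  have hharm : ((harmonic n : ℝ) : ℂ) * s = ∑ m ∈ Finset.range n, s / ((m : ℂ) + 1) := by
    simp only [harmonic, Rat.cast_sum, Finset.sum_mul, Complex.ofReal_sum]
    push_cast
    exact Finset.sum_congr rfl fun m _ => by rw [div_eq_mul_inv, mul_comm]
  have hexp : Complex.exp (∑ m ∈ Finset.range n, Complex.log (1 + s / (m + 1))) =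
      (∏ m ∈ Finset.range n, ((m : ℂ) + 1 + s)) / n.factorial := by
    rw [Complex.exp_sum, ← Finset.prod_range_add_one_eq_factorial, Nat.cast_prod,
      ← Finset.prod_div_distrib]
    refine Finset.prod_congr rfl fun m _ => ?_
    have h2 : (m : ℂ) + 1 ≠ 0 := Nat.cast_add_one_ne_zero m
    have h1 := add_natCast_add_one_ne_zero hs' m
    have : 1 + s / ((m : ℂ) + 1) = (m + 1 + s) / (m + 1) := by field_simp
    rw [this, Complex.exp_log (div_ne_zero h1 h2)]
    push_cast
    rfl
  have hlin : -((((harmonic n : ℝ) - Real.log n : ℝ) : ℂ) * s) -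
      ∑ m ∈ Finset.range n, (Complex.log (1 + s / (m + 1)) - s / (m + 1)) =
      Complex.log n * s - ∑ m ∈ Finset.range n, Complex.log (1 + s / (m + 1)) := by
    rw [Finset.sum_sub_distrib, Complex.ofReal_sub, sub_mul, hharm, Complex.ofReal_log n.cast_nonneg,
      Complex.ofReal_natCast]
    ring
  rw [hlin, Complex.exp_sub, hexp, ← Complex.cpow_def_of_ne_zero hn0, Complex.GammaSeq,
    Finset.prod_range_succ', Nat.cast_zero, add_zero]
  have hP : ∏ m ∈ Finset.range n, (s + ((m + 1 : ℕ) : ℂ)) =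
      ∏ m ∈ Finset.range n, ((m : ℂ) + 1 + s) :=
    Finset.prod_congr rfl fun m _ => by push_cast; ring
  rw [hP]
  have hP0 : ∏ m ∈ Finset.range n, ((m : ℂ) + 1 + s) ≠ 0 :=
    Finset.prod_ne_zero_iff.2 fun m _ => add_natCast_add_one_ne_zero hs' m
  have := Nat.cast_ne_zero (R := ℂ).2 n.factorial_ne_zero
  field_simp

theorem digamma_one_sub_digamma_one_add {s : ℂ} (hs : 0 < s.re) :
    Complex.digamma 1 - Complex.digamma (1 + s) =
      ∑' m : ℕ, (((m : ℂ) + 1 + s)⁻¹ - ((m : ℂ) + 1)⁻¹) := by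
  have hs' : -(1 / 2) < s.re := by linarith
  have hL := (summable_and_hasDerivAt_log_series hs').2
  have hd : HasDerivAt (fun z => Complex.Gamma (1 + z)) (deriv Complex.Gamma (1 + s)) s := by
    refine HasDerivAt.comp_const_add 1 s (Complex.differentiableAt_Gamma _ fun m h => ?_).hasDerivAt
    have := congrArg Complex.re h
    have hm : (0 : ℝ) ≤ m := m.cast_nonneg
    simp at this
    linarith
  have he := ((((hasDerivAt_id s).const_mul (Real.eulerMascheroniConstant : ℂ)).neg.sub hL).cexp)
  have heq : (fun z => Complex.Gamma (1 + z)) =ᶠ[nhds s] fun z =>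
      Complex.exp (-(Real.eulerMascheroniConstant * z) -
      ∑' m : ℕ, (Complex.log (1 + z / (m + 1)) - z / (m + 1))) := by
    filter_upwards [(isOpen_lt continuous_const Complex.continuous_re).mem_nhds hs] with z hz
    exact Gamma_one_add_eq_exp hz
  have hu := (hd.congr_of_eventuallyEq heq.symm).unique he
  rw [Complex.digamma_one, Complex.digamma_def, logDeriv_apply, hu, Gamma_one_add_eq_exp hs]
  simp only [id, Pi.neg_apply, Pi.sub_apply]
  rw [mul_div_cancel_left₀ _ (Complex.exp_ne_zero _)]
  ring

theorem digamma_one_sub_sub_digamma {a : ℂ} (ha : ∀ n : ℤ, a ≠ n) :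
    Complex.digamma (1 - a) - Complex.digamma a = Real.pi * Complex.cot (Real.pi * a) := by
  have hsin : Complex.sin (Real.pi * a) ≠ 0 := by
    rw [Ne, Complex.sin_eq_zero_iff]
    rintro ⟨k, hk⟩
    refine ha k (mul_left_cancel₀ (Complex.ofReal_ne_zero.2 Real.pi_ne_zero) ?_)
    rw [hk, mul_comm]
  have h1 : ∀ m : ℕ, a ≠ -m := fun m h => ha (-m) (by simpa using h)
  have h2 : ∀ m : ℕ, 1 - a ≠ -m := fun m h => ha (m + 1) (by push_cast; linear_combination -h)
  have d1 := (Complex.differentiableAt_Gamma a h1).hasDerivAt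
  have d2 := HasDerivAt.comp_const_sub 1 a (Complex.differentiableAt_Gamma (1 - a) h2).hasDerivAt
  have d3 := (((hasDerivAt_id a).const_mul (Real.pi : ℂ)).csin.inv hsin).const_mul (Real.pi : ℂ)
  have hmul := d1.mul d2
  have heq : (Complex.Gamma * fun x => Complex.Gamma (1 - x)) = fun z =>
      (Real.pi : ℂ) * (fun x => Complex.sin (Real.pi * id x))⁻¹ z := by
    ext z
    simpa [div_eq_mul_inv] using Complex.Gamma_mul_Gamma_one_sub z
  rw [heq] at hmul
  have hu := hmul.unique d3
  have hrefl := Complex.Gamma_mul_Gamma_one_sub a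
  have g1 := Complex.Gamma_ne_zero h1
  have g2 := Complex.Gamma_ne_zero h2
  rw [Complex.digamma_def, logDeriv_apply, logDeriv_apply, Complex.cot_eq_cos_div_sin]
  simp only [id, mul_one] at hu
  rw [div_sub_div _ _ g2 g1, mul_comm (Complex.Gamma (1 - a)) (Complex.Gamma a), hrefl]
  have : deriv Complex.Gamma (1 - a) * Complex.Gamma a -
      Complex.Gamma (1 - a) * deriv Complex.Gamma a =
      Real.pi * (Complex.cos (Real.pi * a) * Real.pi / Complex.sin (Real.pi * a) ^ 2) := by
    linear_combination -hu
  rw [this]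
  have := Complex.ofReal_ne_zero.2 Real.pi_ne_zero
  field_simp

theorem exists_norm_GammaSeq_le (s : ℂ) : ∃ C, ∀ n, ‖Complex.GammaSeq s n‖ ≤ C :=
  let ⟨C, hC⟩ := (Complex.GammaSeq_tendsto_Gamma s).norm.bddAbove_range
  ⟨C, fun n => hC ⟨n, rfl⟩⟩

theorem exists_norm_inv_GammaSeq_le {s : ℂ} (hs : ∀ m : ℕ, s ≠ -m) :
    ∃ C, ∀ n, ‖(Complex.GammaSeq s n)⁻¹‖ ≤ C :=
  let ⟨C, hC⟩ := ((Complex.GammaSeq_tendsto_Gamma s).inv₀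
    (Complex.Gamma_ne_zero hs)).norm.bddAbove_range
  ⟨C, fun n => hC ⟨n, rfl⟩⟩

theorem rf_zero (x : ℂ) : rf x 0 = 1 := by simp [rf]

theorem rf_succ (x : ℂ) (n : ℕ) : rf x (n + 1) = rf x n * (x + n) := Finset.prod_range_succ _ _

theorem rf_succ' (x : ℂ) (n : ℕ) : rf x (n + 1) = x * rf (x + 1) n := by
  rw [rf, Finset.prod_range_succ', Nat.cast_zero, add_zero, mul_comm, rf]
  congr 1
  exact Finset.prod_congr rfl fun j _ => by push_cast; ring

theorem rf_ne_zero {x : ℂ} (hx : ∀ m : ℕ, x ≠ -m) (n : ℕ) : rf x n ≠ 0 :=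
  Finset.prod_ne_zero_iff.2 fun m _ h => hx m (eq_neg_of_add_eq_zero_left h)

theorem summable_norm_rf_div_factorial {a : ℂ} (ha : ∀ m : ℕ, a ≠ -m) (hre : a.re < 0) :
    Summable fun k : ℕ => ‖rf a k / (k.factorial : ℂ)‖ := by
  obtain ⟨C, hC⟩ := exists_norm_inv_GammaSeq_le ha
  rw [← summable_nat_add_iff 1]
  have hs := (Real.summable_nat_rpow (p := a.re - 1)).2 (by linarith)
  refine Summable.of_norm_bounded_eventually_nat (hs.mul_left C) ?_
  filter_upwards [Filter.eventually_gt_atTop 0] with n hn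
  have hn0 : (n : ℂ) ≠ 0 := Nat.cast_ne_zero.2 hn.ne'
  have hnr : (0 : ℝ) < n := Nat.cast_pos.2 hn
  have hf := Nat.cast_ne_zero (R := ℂ).2 n.factorial_ne_zero
  have hp : (n : ℂ) ^ a ≠ 0 := by simp [Complex.cpow_eq_zero_iff, hn0]
  have heq : rf a (n + 1) / ((n + 1).factorial : ℂ) =
      (Complex.GammaSeq a n)⁻¹ * ((n : ℂ) ^ a / ((n + 1 : ℕ) : ℂ)) := by
    rw [Complex.GammaSeq, Nat.factorial_succ, Nat.cast_mul]
    have := Nat.cast_ne_zero (R := ℂ).2 n.succ_ne_zero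
    change rf a (n + 1) / _ = ((n : ℂ) ^ a * _ / rf a (n + 1))⁻¹ * _
    field_simp
  rw [norm_norm, heq, norm_mul, norm_div, Complex.norm_natCast_cpow_of_pos hn,
    Complex.norm_natCast, Real.rpow_sub_one hnr.ne']
  have := (norm_nonneg _).trans (hC 0)
  gcongr
  · exact hC n
  · simp

theorem summable_norm_factorial_div_rf {d : ℂ} (hd : 1 < d.re) :
    Summable fun k : ℕ => ‖(k.factorial : ℂ) / rf d (k + 1)‖ := by
  obtain ⟨C, hC⟩ := exists_norm_GammaSeq_le d
  have hs := (Real.summable_nat_rpow (p := -d.re)).2 (by linarith)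
  refine Summable.of_norm_bounded_eventually_nat (hs.mul_left C) ?_
  filter_upwards [Filter.eventually_gt_atTop 0] with n hn
  have hn0 : (n : ℂ) ≠ 0 := Nat.cast_ne_zero.2 hn.ne'
  have hp : (n : ℂ) ^ d ≠ 0 := by simp [Complex.cpow_eq_zero_iff, hn0]
  have heq : (n.factorial : ℂ) / rf d (n + 1) = Complex.GammaSeq d n * (n : ℂ) ^ (-d) := by
    rw [Complex.cpow_neg, Complex.GammaSeq]
    change _ = ((n : ℂ) ^ d * _ / rf d (n + 1)) * _
    field_simp
  rw [norm_norm, heq, norm_mul, Complex.norm_natCast_cpow_of_pos hn, Complex.neg_re]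
  gcongr
  exact hC n

theorem ne_neg_natCast_of_re_pos {d : ℂ} (hd : 0 < d.re) (m : ℕ) : d ≠ -m := fun h => by
  have := congrArg Complex.re h
  have hm : (0 : ℝ) ≤ m := m.cast_nonneg
  simp at this
  linarith

theorem summable_alternating_factorial_div_rf {d : ℂ} (hd : 1 < d.re) :
    Summable fun k : ℕ => (-1 : ℂ) ^ k * (k.factorial : ℂ) / rf d (k + 1) :=
  Summable.of_norm_bounded (summable_norm_factorial_div_rf hd) fun k => by simp

theorem tsum_factorial_div_rf_step {d : ℂ} (hd : 1 < d.re) :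
    ∑' k : ℕ, (-1 : ℂ) ^ k * (k.factorial : ℂ) / rf d (k + 1) =
      (1 / 2) / d + (1 / 2) *
        ∑' k : ℕ, (-1 : ℂ) ^ k * (k.factorial : ℂ) / rf (d + 1) (k + 1) := by
  have hs := summable_alternating_factorial_div_rf hd
  have hs1 := summable_alternating_factorial_div_rf (d := d + 1) (by simp; linarith)
  have h0 := ne_neg_natCast_of_re_pos (d := d) (by linarith)
  have h1 := ne_neg_natCast_of_re_pos (d := d + 1) (by simp; linarith)
  have key : ∀ k : ℕ, (-1 : ℂ) ^ k * (k.factorial : ℂ) / rf d (k + 1) +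
      (-1 : ℂ) ^ (k + 1) * ((k + 1).factorial : ℂ) / rf d (k + 1 + 1) =
      (-1 : ℂ) ^ k * (k.factorial : ℂ) / rf (d + 1) (k + 1) := fun k => by
    have e1 : d ≠ 0 := by simpa using h0 0
    have e2 := rf_ne_zero h1 k
    have e3 : d + 1 + k ≠ 0 := fun h => h1 k (eq_neg_of_add_eq_zero_left h)
    rw [rf_succ' d k, rf_succ' d (k + 1), rf_succ (d + 1) k, Nat.factorial_succ]
    push_cast
    field_simp
    ring
  have hsum := hs.tsum_add ((summable_nat_add_iff 1).2 hs)
  rw [tsum_congr key] at hsum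
  have hz := hs.tsum_eq_zero_add
  rw [rf_succ, rf_zero] at hz
  simp only [pow_zero, Nat.factorial_zero, Nat.cast_one, Nat.cast_zero, add_zero, one_mul] at hz
  linear_combination (1 / 2 : ℂ) * hz - (1 / 2 : ℂ) * hsum

theorem norm_tsum_factorial_div_rf_add_le {d : ℂ} (hd : 1 < d.re) (n : ℕ) :
    ‖∑' k : ℕ, (-1 : ℂ) ^ k * (k.factorial : ℂ) / rf (d + n) (k + 1)‖ ≤
      ∑' k : ℕ, ‖(k.factorial : ℂ) / rf d (k + 1)‖ := by
  refine tsum_of_norm_bounded (summable_norm_factorial_div_rf hd).hasSum fun k => ?_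
  rw [norm_div, norm_div, norm_mul, norm_pow, norm_neg, norm_one, one_pow, one_mul]
  have h0 := ne_neg_natCast_of_re_pos (d := d) (by linarith)
  have := norm_pos_iff.2 (rf_ne_zero h0 (k + 1))
  gcongr
  rw [rf, rf, norm_prod, norm_prod]
  refine Finset.prod_le_prod (fun _ _ => norm_nonneg _) fun j _ => ?_
  rw [Complex.norm_def, Complex.norm_def]
  refine Real.sqrt_le_sqrt ?_
  have hj : (0 : ℝ) ≤ j := j.cast_nonneg
  have hn : (0 : ℝ) ≤ n := n.cast_nonneg
  simp only [Complex.normSq_apply, Complex.add_re, Complex.add_im, Complex.natCast_re,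
    Complex.natCast_im, add_zero]
  nlinarith

/-- The Euler transformation of the series `∑ (-1)ᵏ k! / (d)ₖ₊₁`. -/
theorem tsum_factorial_div_rf_eq {d : ℂ} (hd : 1 < d.re)
    (hs : Summable fun m : ℕ => (1 / 2 : ℂ) ^ (m + 1) / (d + m)) :
    ∑' k : ℕ, (-1 : ℂ) ^ k * (k.factorial : ℂ) / rf d (k + 1) =
      ∑' m : ℕ, (1 / 2 : ℂ) ^ (m + 1) / (d + m) := by
  have hrec : ∀ n : ℕ, ∑' k : ℕ, (-1 : ℂ) ^ k * (k.factorial : ℂ) / rf d (k + 1) =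
      ∑ m ∈ Finset.range n, (1 / 2 : ℂ) ^ (m + 1) / (d + m) + (1 / 2 : ℂ) ^ n *
        ∑' k : ℕ, (-1 : ℂ) ^ k * (k.factorial : ℂ) / rf (d + n) (k + 1) := by
    intro n
    induction n with
    | zero => simp
    | succ n ih =>
      rw [ih, tsum_factorial_div_rf_step (d := d + n) (by
        have hn : (0 : ℝ) ≤ n := n.cast_nonneg
        simp
        linarith), Finset.sum_range_succ]
      push_cast
      rw [add_assoc d]
      ring
  have hlim : Filter.Tendsto (fun n : ℕ => (1 / 2 : ℂ) ^ n *
      ∑' k : ℕ, (-1 : ℂ) ^ k * (k.factorial : ℂ) / rf (d + n) (k + 1)) Filter.atTop (nhds 0) := by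
    refine squeeze_zero_norm (a := fun n : ℕ => (1 / 2 : ℝ) ^ n *
      ∑' k : ℕ, ‖(k.factorial : ℂ) / rf d (k + 1)‖) (fun n => ?_) ?_
    · rw [norm_mul, norm_pow]
      have : ‖(1 / 2 : ℂ)‖ = 1 / 2 := by norm_num
      rw [this]
      gcongr
      exact norm_tsum_factorial_div_rf_add_le hd n
    · simpa using (tendsto_pow_atTop_nhds_zero_of_lt_one (r := (1 / 2 : ℝ)) (by norm_num)
        (by norm_num)).mul_const (∑' k : ℕ, ‖(k.factorial : ℂ) / rf d (k + 1)‖)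
  have h := hs.hasSum.tendsto_sum_nat.add hlim
  rw [add_zero] at h
  exact tendsto_nhds_unique (tendsto_const_nhds.congr hrec) h

theorem tsum_binomial_eq {a : ℂ} (ha : ∀ m : ℕ, a ≠ -m) (hre : a.re < 0) {x : ℝ}
    (hx : x ∈ Set.Icc (0 : ℝ) 1) :
    Complex.exp (a * (Real.log (1 + x) : ℂ)) *
      ∑' k : ℕ, (-1 : ℂ) ^ k * (rf a k / (k.factorial : ℂ)) * (x : ℂ) ^ k = 1 := by
  set β : ℕ → ℂ := fun k => (-1 : ℂ) ^ k * (rf a k / (k.factorial : ℂ)) with hβ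
  have hβs : Summable fun k => ‖β k‖ :=
    (summable_norm_rf_div_factorial ha hre).congr fun k => by simp [hβ]
  have hβb : ∀ k, ‖β k‖ ≤ ∑' j, ‖β j‖ := fun k => hβs.le_tsum k fun _ _ => norm_nonneg _
  have hrec : ∀ k : ℕ, ((k : ℂ) + 1) * β (k + 1) + k * β k = -a * β k := fun k => by
    have h1 := Nat.cast_ne_zero (R := ℂ).2 k.factorial_ne_zero
    have h2 := Nat.cast_add_one_ne_zero (R := ℂ) k
    simp only [hβ, rf_succ, Nat.factorial_succ]
    push_cast
    field_simp
    ring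
  have hcont : ContinuousOn (fun t : ℝ => Complex.exp (a * (Real.log (1 + t) : ℂ)) *
      ∑' k : ℕ, β k * (t : ℂ) ^ k) (Set.Icc 0 1) := by
    refine ContinuousOn.mul ?_ (continuousOn_tsum_mul_pow hβs)
    refine (continuousOn_const.mul (Complex.continuous_ofReal.comp_continuousOn
      (ContinuousOn.log (by fun_prop) fun t ht => ?_))).cexp
    linarith [ht.1]
  have h := constant_of_has_deriv_right_zero hcont (fun t ht => ?_) x hx
  · rw [h, tsum_eq_single 0 (fun k hk => by simp [hk])]
    simp [hβ, rf_zero]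
  · have ht1 : |t| < 1 := by rw [abs_of_nonneg ht.1]; exact ht.2
    have ht0 : 1 + t ≠ 0 := by linarith [ht.1]
    have ht0' : 1 + (t : ℂ) ≠ 0 := by exact_mod_cast ht0
    have he := (((((hasDerivAt_id t).const_add 1).log ht0).ofReal_comp).const_mul a).cexp
    have hd := he.mul (hasDerivAt_tsum_mul_pow hβb ht1)
    refine (hd.congr_deriv ?_).hasDerivWithinAt
    have hsum : ∑' k : ℕ, ((k : ℂ) + 1) * β (k + 1) * (t : ℂ) ^ k +
        ∑' k : ℕ, (k : ℂ) * β k * (t : ℂ) ^ k = -a * ∑' k : ℕ, β k * (t : ℂ) ^ k := by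
      have hs := (summable_mul_pow hβb ht1).mul_left (-a)
      have hs' := summable_natCast_mul_mul_pow hβb ht1
      rw [← tsum_mul_left, ← Summable.tsum_add _ hs']
      · exact tsum_congr fun k => by linear_combination (t : ℂ) ^ k * hrec k
      · exact (hs.sub hs').congr fun k => by linear_combination (-(t : ℂ) ^ k) * hrec k
    rw [← mul_tsum_succ_mul_pow hβb ht1] at hsum
    simp only [id]
    push_cast
    field_simp
    linear_combination Complex.exp (a * (Real.log (1 + t) : ℂ)) * hsum

theorem norm_inv_natCast_sub_le {a : ℂ} (hre : a.re < 0) (k : ℕ) :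
    ‖((k : ℂ) - a)⁻¹‖ ≤ (-a.re)⁻¹ := by
  rw [norm_inv]
  refine inv_anti₀ (by linarith) (le_trans ?_ (Complex.re_le_norm _))
  simp

theorem natCast_sub_ne_zero {a : ℂ} (hre : a.re < 0) (k : ℕ) : (k : ℂ) - a ≠ 0 := fun h => by
  have := congrArg Complex.re h
  have hk : (0 : ℝ) ≤ k := k.cast_nonneg
  simp at this
  linarith

theorem hasDerivAt_tsum_pow_div_sub {a : ℂ} (hre : a.re < 0) {x : ℝ} (hx : 0 < x) :
    HasDerivAt (fun t : ℝ => ∑' k : ℕ, ((k : ℂ) - a)⁻¹ * (((1 + t)⁻¹ : ℝ) : ℂ) ^ k)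
      (-(1 + x)⁻¹ * ((1 + x) / x +
        a * ∑' k : ℕ, ((k : ℂ) - a)⁻¹ * (((1 + x)⁻¹ : ℝ) : ℂ) ^ k)) x := by
  have h1 : 0 < 1 + x := by linarith
  have hy0 : 0 < (1 + x)⁻¹ := inv_pos.2 h1
  have hy : |(1 + x)⁻¹| < 1 := by
    rw [abs_of_pos hy0]
    exact inv_lt_one_of_one_lt₀ (by linarith)
  have hb := norm_inv_natCast_sub_le hre
  have hin : HasDerivAt (fun t : ℝ => (1 + t)⁻¹) (-1 / (1 + x) ^ 2) x :=
    ((hasDerivAt_id x).const_add 1).inv h1.ne'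
  have hd := (hasDerivAt_tsum_mul_pow hb hy).scomp x hin
  refine hd.congr_deriv ?_
  have hm := mul_tsum_succ_mul_pow hb hy
  have hg := hasSum_geometric_of_norm_lt_one (ξ := (((1 + x)⁻¹ : ℝ) : ℂ))
    (by rwa [Complex.norm_real, Real.norm_eq_abs])
  have hS := (summable_mul_pow hb hy).hasSum
  have hs := (hg.add (hS.mul_left a)).tsum_eq
  have hx' : (x : ℂ) ≠ 0 := by exact_mod_cast hx.ne'
  have h1' : 1 + (x : ℂ) ≠ 0 := by exact_mod_cast h1.ne'
  have heq : ∑' k : ℕ, (k : ℂ) * ((k : ℂ) - a)⁻¹ * (((1 + x)⁻¹ : ℝ) : ℂ) ^ k =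
      (1 - (((1 + x)⁻¹ : ℝ) : ℂ))⁻¹ +
        a * ∑' k : ℕ, ((k : ℂ) - a)⁻¹ * (((1 + x)⁻¹ : ℝ) : ℂ) ^ k := by
    rw [← hs]
    refine tsum_congr fun k => ?_
    have := natCast_sub_ne_zero hre k
    field_simp
    ring
  rw [heq] at hm
  have hinv : (1 - (((1 + x)⁻¹ : ℝ) : ℂ))⁻¹ = (1 + x) / x := by
    push_cast
    have : 1 - (1 + (x : ℂ))⁻¹ = x / (1 + x) := by
      field_simp
      ring
    rw [this, inv_div]
  rw [hinv] at hm
  rw [← hm, Complex.real_smul]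
  push_cast
  field_simp

theorem tsum_inv_sub_mul_pow_eq {a : ℂ} (hre : a.re < 0) {y : ℝ} (hy0 : 0 < y) (hy1 : y < 1) :
    ∑' k : ℕ, ((k : ℂ) - a)⁻¹ * (y : ℂ) ^ k + a⁻¹ =
      y * ∑' m : ℕ, (((m : ℂ) + 1 + -a)⁻¹ - ((m : ℂ) + 1)⁻¹) * (y : ℂ) ^ m -
        (Real.log (1 - y) : ℂ) := by
  have hy : |y| < 1 := by rwa [abs_of_pos hy0]
  have hS := summable_mul_pow (norm_inv_natCast_sub_le hre) hy
  have hlog := (Complex.hasSum_taylorSeries_neg_log (z := (y : ℂ))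
    (by rwa [Complex.norm_real, Real.norm_eq_abs]))
  have hl : Complex.log (1 - y) = (Real.log (1 - y) : ℂ) := by
    rw [Complex.ofReal_log (by linarith)]
    push_cast
    rfl
  rw [hl] at hlog
  have h1 := hlog.summable.tsum_eq_zero_add
  rw [hlog.tsum_eq] at h1
  rw [hS.tsum_eq_zero_add, sub_eq_add_neg (_ * _) (Real.log (1 - y) : ℂ), h1, ← tsum_mul_left]
  simp only [Nat.cast_zero, zero_sub, pow_zero, mul_one, div_zero, zero_add]
  have hs1 := (summable_nat_add_iff 1).2 hS
  have hs2 := (summable_nat_add_iff 1).2 hlog.summable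
  rw [← Summable.tsum_add _ hs2, inv_neg]
  · rw [neg_add_cancel_comm]
    refine tsum_congr fun k => ?_
    have := Nat.cast_add_one_ne_zero (R := ℂ) k
    push_cast
    rw [sub_eq_add_neg _ a]
    field_simp
    ring
  · refine (hs1.sub hs2).congr fun k => ?_
    have := Nat.cast_add_one_ne_zero (R := ℂ) k
    push_cast
    rw [sub_eq_add_neg _ a]
    field_simp
    ring

theorem tendsto_exp_sub_one_mul_log (a : ℂ) :
    Filter.Tendsto (fun x : ℝ =>
      (Complex.exp (a * (Real.log (1 + x) : ℂ)) - 1) * (Real.log x : ℂ))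
      (nhdsWithin 0 (Set.Ioi 0)) (nhds 0) := by
  have hd : HasDerivAt (fun x : ℝ => Complex.exp (a * (Real.log (1 + x) : ℂ))) _ 0 :=
    (((((hasDerivAt_id (0 : ℝ)).const_add 1).log (by simp)).ofReal_comp).const_mul a).cexp
  have h1 := (hasDerivAt_iff_tendsto_slope.1 hd).mono_left
    (nhdsWithin_mono _ fun x (hx : 0 < x) => hx.ne')
  have h2 : Filter.Tendsto (fun x : ℝ => ((Real.log x * x : ℝ) : ℂ))
      (nhdsWithin 0 (Set.Ioi 0)) (nhds ((0 : ℝ) : ℂ)) :=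
    (Complex.continuous_ofReal.tendsto _).comp
      (by simpa using tendsto_log_mul_rpow_nhdsGT_zero zero_lt_one)
  have h3 := h1.mul h2
  rw [Complex.ofReal_zero, mul_zero] at h3
  refine h3.congr' ?_
  filter_upwards [self_mem_nhdsWithin] with x hx
  have hx' : (x : ℂ) ≠ 0 := by exact_mod_cast (Set.mem_Ioi.1 hx).ne'
  simp only [slope_def_module, sub_zero, add_zero, Real.log_one, Complex.ofReal_zero, mul_zero,
    Complex.exp_zero, Complex.real_smul]
  push_cast
  field_simp

theorem exists_norm_le_of_rec {a : ℂ} {E : ℕ → ℂ}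
    (hE : ∀ k : ℕ, E (k + 1) = E k + ((k : ℂ) + 1)⁻¹ - (a + k)⁻¹) : ∃ B, ∀ k, ‖E k‖ ≤ B := by
  obtain ⟨N, hN⟩ := exists_nat_gt (-a.re + 1)
  have hs : Summable fun m : ℕ => ((m : ℂ) + 1 + (a + N - 1))⁻¹ - ((m : ℂ) + 1)⁻¹ :=
    summable_inv_sub_inv (by simp; linarith)
  have hs' : Summable fun m : ℕ => ((m : ℂ) + 1)⁻¹ - ((m : ℂ) + 1 + N)⁻¹ := by
    refine (summable_inv_sub_inv (s := N) ?_).neg.congr fun m => by ring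
    have : (0 : ℝ) ≤ N := N.cast_nonneg
    simp
    linarith
  have hsum : ∀ n : ℕ, E (n + N) = E N - ∑ m ∈ Finset.range n,
      ((((m : ℂ) + 1 + (a + N - 1))⁻¹ - ((m : ℂ) + 1)⁻¹) +
        (((m : ℂ) + 1)⁻¹ - ((m : ℂ) + 1 + N)⁻¹)) := fun n => by
    induction n with
    | zero => simp
    | succ n ih =>
      have e : (a + ((n + N : ℕ) : ℂ)) = (n : ℂ) + 1 + (a + N - 1) := by push_cast; ring
      have e' : ((n + N : ℕ) : ℂ) + 1 = (n : ℂ) + 1 + N := by push_cast; ring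
      rw [add_right_comm, hE, ih, Finset.sum_range_succ, e, e']
      ring
  have ht := ((hs.add hs').hasSum.tendsto_sum_nat.const_sub (E N)).congr fun n => (hsum n).symm
  obtain ⟨B, hB⟩ := ((Filter.tendsto_add_atTop_iff_nat N).1 ht).norm.bddAbove_range
  exact ⟨B, fun k => hB ⟨k, rfl⟩⟩

theorem summable_norm_binomial_mul {a : ℂ} (ha : ∀ m : ℕ, a ≠ -m) (hre : a.re < 0) {E : ℕ → ℂ}
    (hE : ∀ k : ℕ, E (k + 1) = E k + ((k : ℂ) + 1)⁻¹ - (a + k)⁻¹) :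
    Summable fun k : ℕ => ‖(-1 : ℂ) ^ k * (rf a k / (k.factorial : ℂ)) * E k‖ := by
  obtain ⟨B, hB⟩ := exists_norm_le_of_rec hE
  refine Summable.of_norm_bounded ((summable_norm_rf_div_factorial ha hre).mul_right B)
    fun k => ?_
  rw [norm_norm, norm_mul, norm_mul, norm_pow, norm_neg, norm_one, one_pow, one_mul]
  gcongr
  exact hB k

/-- The differential equation satisfied by the generating function of `(-1)ᵏ (a)ₖ / k! * E k`. -/
theorem generating_function_ode {a : ℂ} (ha : ∀ m : ℕ, a ≠ -m) (hre : a.re < 0) {E : ℕ → ℂ}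
    (hE : ∀ k : ℕ, E (k + 1) = E k + ((k : ℂ) + 1)⁻¹ - (a + k)⁻¹)
    {x : ℝ} (hx : x ∈ Set.Ioo (0 : ℝ) 1) :
    HasDerivAt (fun t : ℝ => Complex.exp (a * (Real.log (1 + t) : ℂ)) *
        ∑' k : ℕ, (-1 : ℂ) ^ k * (rf a k / (k.factorial : ℂ)) * E k * (t : ℂ) ^ k)
      ((1 : ℂ) / x - Complex.exp (a * (Real.log (1 + x) : ℂ)) / (x * (1 + x))) x := by
  have hbin := tsum_binomial_eq ha hre ⟨hx.1.le, hx.2.le⟩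
  set β : ℕ → ℂ := fun k => (-1 : ℂ) ^ k * (rf a k / (k.factorial : ℂ)) with hβ
  have hβs : Summable fun k => ‖β k‖ :=
    (summable_norm_rf_div_factorial ha hre).congr fun k => by simp [hβ]
  have hβb : ∀ k, ‖β k‖ ≤ ∑' j, ‖β j‖ := fun k => hβs.le_tsum k fun _ _ => norm_nonneg _
  set u : ℕ → ℂ := fun k => (-1 : ℂ) ^ k * (rf a k / (k.factorial : ℂ)) * E k with hu
  have hus : Summable fun k => ‖u k‖ := summable_norm_binomial_mul ha hre hE
  have hub : ∀ k, ‖u k‖ ≤ ∑' j, ‖u j‖ := fun k => hus.le_tsum k fun _ _ => norm_nonneg _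
  have hrec : ∀ k : ℕ, ((k : ℂ) + 1) * u (k + 1) + k * u k = -a * u k + (β (k + 1) + β k) :=
    fun k => by
    have h1 := Nat.cast_ne_zero (R := ℂ).2 k.factorial_ne_zero
    have h2 := Nat.cast_add_one_ne_zero (R := ℂ) k
    have h3 : a + k ≠ 0 := fun h => ha k (eq_neg_of_add_eq_zero_left h)
    simp only [hβ, hu, hE, rf_succ, Nat.factorial_succ]
    push_cast
    field_simp
    ring
  have hx1 : |x| < 1 := by rw [abs_of_pos hx.1]; exact hx.2
  have hx0 : (x : ℂ) ≠ 0 := by exact_mod_cast hx.1.ne'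
  have h1x : 1 + x ≠ 0 := by linarith [hx.1]
  have h1x' : 1 + (x : ℂ) ≠ 0 := by exact_mod_cast h1x
  have he := (((((hasDerivAt_id x).const_add 1).log h1x).ofReal_comp).const_mul a).cexp
  refine (he.mul (hasDerivAt_tsum_mul_pow hub hx1)).congr_deriv ?_
  have hb := summable_mul_pow hβb hx1
  have hb' : Summable fun k : ℕ => β (k + 1) * (x : ℂ) ^ k :=
    summable_mul_pow (fun k => hβb (k + 1)) hx1
  have hbz : ∑' k, β k * (x : ℂ) ^ k = 1 + x * ∑' k : ℕ, β (k + 1) * (x : ℂ) ^ k := by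
    rw [hb.tsum_eq_zero_add, ← tsum_mul_left]
    congr 1
    · simp [hβ, rf_zero]
    · exact tsum_congr fun k => by ring
  have hsum : ∑' k : ℕ, ((k : ℂ) + 1) * u (k + 1) * (x : ℂ) ^ k +
      ∑' k : ℕ, (k : ℂ) * u k * (x : ℂ) ^ k = -a * ∑' k : ℕ, u k * (x : ℂ) ^ k +
        (∑' k : ℕ, β (k + 1) * (x : ℂ) ^ k + ∑' k : ℕ, β k * (x : ℂ) ^ k) := by
    have hs := (summable_mul_pow hub hx1).mul_left (-a)
    have hs' := summable_natCast_mul_mul_pow hub hx1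
    rw [← tsum_mul_left, ← hb'.tsum_add hb, ← hs.tsum_add (hb'.add hb),
      ← Summable.tsum_add _ hs']
    · exact tsum_congr fun k => by linear_combination (x : ℂ) ^ k * hrec k
    · exact ((hs.add (hb'.add hb)).sub hs').congr fun k => by
        linear_combination (-(x : ℂ) ^ k) * hrec k
  rw [← mul_tsum_succ_mul_pow hub hx1] at hsum
  simp only [id]
  push_cast
  set e := Complex.exp (a * (Real.log (1 + x) : ℂ))
  field_simp
  linear_combination (e * x) * hsum - e * hbz + (1 + (x : ℂ)) * hbin

theorem tsum_binomial_mul_eq {a : ℂ} (ha : ∀ m : ℕ, a ≠ -m) (hre : a.re < 0) {E : ℕ → ℂ}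
    (hE : ∀ k : ℕ, E (k + 1) = E k + ((k : ℂ) + 1)⁻¹ - (a + k)⁻¹)
    (hE0 : E 0 = ∑' m : ℕ, (((m : ℂ) + 1 + -a)⁻¹ - ((m : ℂ) + 1)⁻¹)) :
    ∑' k : ℕ, (-1 : ℂ) ^ k * (rf a k / (k.factorial : ℂ)) * E k =
      ∑' k : ℕ, ((k : ℂ) - a)⁻¹ * (1 / 2 : ℂ) ^ k + a⁻¹ := by
  have hode := fun x hx => generating_function_ode ha hre hE (x := x) hx
  have hus := summable_norm_binomial_mul ha hre hE
  set u : ℕ → ℂ := fun k => (-1 : ℂ) ^ k * (rf a k / (k.factorial : ℂ)) * E k with hu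
  have hfc := continuousOn_tsum_mul_pow hus
  set f : ℝ → ℂ := fun t => ∑' k : ℕ, u k * (t : ℂ) ^ k with hf
  set S : ℝ → ℂ := fun t => ∑' k : ℕ, ((k : ℂ) - a)⁻¹ * (((1 + t)⁻¹ : ℝ) : ℂ) ^ k with hS
  set e : ℝ → ℂ := fun t => Complex.exp (a * (Real.log (1 + t) : ℂ)) with he
  set h : ℝ → ℂ := fun t => e t * f t - e t * (S t + a⁻¹) - (Real.log t : ℂ) with hh
  have hSd : ∀ x : ℝ, 0 < x → HasDerivAt S (-(1 + x)⁻¹ * ((1 + x) / x + a * S x)) x :=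
    fun x hx => hasDerivAt_tsum_pow_div_sub hre hx
  have hed : ∀ x : ℝ, 0 ≤ x → HasDerivAt e (e x * (a * ((1 / (1 + x) : ℝ) : ℂ))) x :=
    fun x hx => (((((hasDerivAt_id x).const_add 1).log
      (by simp only [id]; linarith)).ofReal_comp).const_mul a).cexp
  have hld : ∀ x : ℝ, 0 < x → HasDerivAt (fun t : ℝ => (Real.log t : ℂ)) ((x⁻¹ : ℝ) : ℂ) x :=
    fun x hx => (Real.hasDerivAt_log hx.ne').ofReal_comp
  have hc : ContinuousOn h (Set.Ioc 0 1) := fun x hx =>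
    ((((hed x hx.1.le).continuousAt.continuousWithinAt).mul
      ((hfc x ⟨hx.1.le, hx.2⟩).mono Set.Ioc_subset_Icc_self)).sub
    ((hed x hx.1.le).continuousAt.mul
      ((hSd x hx.1).continuousAt.add continuousAt_const)).continuousWithinAt).sub
    (hld x hx.1).continuousAt.continuousWithinAt
  have hd : ∀ x ∈ Set.Ioo (0 : ℝ) 1, HasDerivAt h 0 x := fun x hx => by
    refine (((hode x hx).sub ((hed x hx.1.le).mul ((hSd x hx.1).add_const a⁻¹))).sub
      (hld x hx.1)).congr_deriv ?_
    have hx0 : (x : ℂ) ≠ 0 := by exact_mod_cast hx.1.ne'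
    have h1x' : 1 + (x : ℂ) ≠ 0 := by
      have : 1 + x ≠ 0 := by linarith [hx.1]
      exact_mod_cast this
    have ha0 : a ≠ 0 := by simpa using ha 0
    change 1 / (x : ℂ) - e x / (x * (1 + x)) - _ - _ = _
    push_cast
    field_simp
    ring
  have hlim : Filter.Tendsto h (nhdsWithin 0 (Set.Ioi 0)) (nhds 0) := by
    have hwc := continuousOn_tsum_mul_pow (summable_inv_sub_inv (s := -a) (by simp; linarith)).norm
    set U : ℝ → ℂ := fun t => ∑' m : ℕ, (((m : ℂ) + 1 + -a)⁻¹ - ((m : ℂ) + 1)⁻¹) * (t : ℂ) ^ m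
      with hU
    have hsub : nhdsWithin (0 : ℝ) (Set.Ioi 0) ≤ nhds 0 := nhdsWithin_le_nhds
    have hinv : Filter.Tendsto (fun x : ℝ => (1 + x)⁻¹) (nhdsWithin 0 (Set.Ioi 0)) (nhds 1) := by
      have : ContinuousAt (fun x : ℝ => (1 + x)⁻¹) 0 :=
        ContinuousAt.inv₀ (by fun_prop) (by simp)
      have h2 := this.tendsto.mono_left hsub
      simpa using h2
    have hUl : Filter.Tendsto (fun x : ℝ => U (1 + x)⁻¹) (nhdsWithin 0 (Set.Ioi 0))
        (nhds (E 0)) := by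
      have h1 : U 1 = E 0 := by simp [hU, hE0]
      rw [← h1]
      refine (hwc 1 (by simp)).tendsto.comp (tendsto_nhdsWithin_iff.2 ⟨hinv, ?_⟩)
      filter_upwards [self_mem_nhdsWithin] with x hx
      have hx0 : 0 < x := hx
      exact ⟨by positivity, inv_le_one_of_one_le₀ (by linarith)⟩
    have hfl : Filter.Tendsto f (nhdsWithin 0 (Set.Ioi 0)) (nhds (E 0)) := by
      have h0 : f 0 = E 0 := by
        simp only [hf]
        rw [tsum_eq_single 0 (fun k hk => by simp [hk])]
        simp [hu, rf_zero]
      rw [← h0]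
      refine (hfc 0 (by simp)).tendsto.mono_left ?_
      rw [← nhdsWithin_Ioo_eq_nhdsGT (zero_lt_one (α := ℝ))]
      exact nhdsWithin_mono _ Set.Ioo_subset_Icc_self
    have hel : Filter.Tendsto e (nhdsWithin 0 (Set.Ioi 0)) (nhds 1) := by
      have := (hed 0 le_rfl).continuousAt.tendsto.mono_left hsub
      simpa [he] using this
    have hll : Filter.Tendsto (fun x : ℝ => (Real.log (1 + x) : ℂ)) (nhdsWithin 0 (Set.Ioi 0))
        (nhds 0) := by
      have : ContinuousAt (fun x : ℝ => (Real.log (1 + x) : ℂ)) 0 :=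
        Complex.continuous_ofReal.continuousAt.comp
          (ContinuousAt.log (by fun_prop) (by simp))
      have h2 := this.tendsto.mono_left hsub
      simpa using h2
    have hil : Filter.Tendsto (fun x : ℝ => (((1 + x)⁻¹ : ℝ) : ℂ)) (nhdsWithin 0 (Set.Ioi 0))
        (nhds ((1 : ℝ) : ℂ)) := (Complex.continuous_ofReal.tendsto _).comp hinv
    have hT := (hel.mul ((hfl.sub (hil.mul hUl)).sub hll)).add (tendsto_exp_sub_one_mul_log a)
    simp only [Complex.ofReal_one, one_mul, sub_self, add_zero] at hT
    refine hT.congr' ?_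
    filter_upwards [self_mem_nhdsWithin] with x hx
    have hx0 : 0 < x := hx
    have h1x : 0 < 1 + x := by linarith
    have hy : (1 + x)⁻¹ < 1 := inv_lt_one_of_one_lt₀ (by linarith)
    have hSx := tsum_inv_sub_mul_pow_eq hre (inv_pos.2 h1x) hy
    have hlog : Real.log (1 - (1 + x)⁻¹) = Real.log x - Real.log (1 + x) := by
      rw [← Real.log_div hx0.ne' h1x.ne']
      congr 1
      field_simp
      ring
    rw [hlog, Complex.ofReal_sub] at hSx
    change S x + a⁻¹ = _ * U (1 + x)⁻¹ - _ at hSx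
    simp only [hh]
    rw [hSx]
    change _ + (e x - 1) * _ = _
    ring
  have hh1 : h 1 = 0 := by
    refine tendsto_nhds_unique (tendsto_const_nhds.congr' ?_) hlim
    filter_upwards [Ioc_mem_nhdsGT (zero_lt_one (α := ℝ))] with x hx
    exact (eq_of_hasDerivAt_zero hc hd hx).symm
  have he1 : e 1 ≠ 0 := Complex.exp_ne_zero _
  have hfin : f 1 = S 1 + a⁻¹ := by
    refine mul_left_cancel₀ he1 ?_
    simpa [hh, sub_eq_zero] using hh1
  simp only [hf, hS, Complex.ofReal_one, one_pow, mul_one] at hfin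
  rw [hfin]
  norm_num

theorem stmt10 (a : ℂ) (ha : ∀ n : ℤ, a ≠ n) (hre : a.re < 0) :
    Summable (fun k : ℕ => rf a k * (-1 : ℂ) ^ k / (Nat.factorial k : ℂ) *
        (ψ (1 + k) - ψ (a + k))) ∧
    Summable (fun k : ℕ => (-1 : ℂ) ^ k * (Nat.factorial k : ℂ) / rf (2 - a) k) ∧
    (∑' k : ℕ, rf a k * (-1 : ℂ) ^ k / (Nat.factorial k : ℂ) * (ψ (1 + k) - ψ (a + k))) =
      (Real.pi : ℂ) * Complex.cot ((Real.pi : ℂ) * a) * Complex.exp (-a * Complex.log 2) +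
      (1 / (1 - a)) * ∑' k : ℕ, (-1 : ℂ) ^ k * (Nat.factorial k : ℂ) / rf (2 - a) k := by
  have ha' : ∀ m : ℕ, a ≠ -m := fun m h => ha (-m) (by simpa using h)
  have hψ : ∀ z, ψ z = Complex.digamma z := fun z => by
    rw [Complex.digamma_def, logDeriv_apply, ψ]
  have hD : ∀ k : ℕ, ψ (1 + (k + 1 : ℕ)) - ψ (a + (k + 1 : ℕ)) =
      ψ (1 + k) - ψ (a + k) + ((k : ℂ) + 1)⁻¹ - (a + k)⁻¹ := fun k => by
    have h1 := Complex.digamma_apply_add_one (1 + (k : ℂ))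
      (ne_neg_natCast_of_re_pos (by
        have hk : (0 : ℝ) ≤ k := k.cast_nonneg
        simp
        linarith))
    have h2 := Complex.digamma_apply_add_one (a + (k : ℂ)) (fun m h => ha' (m + k) (by
      push_cast
      linear_combination h))
    simp only [hψ]
    push_cast
    rw [← add_assoc, ← add_assoc, h1, h2, add_comm (1 : ℂ) k]
    ring
  set κ : ℂ := Real.pi * Complex.cot (Real.pi * a) with hκ
  have hE : ∀ k : ℕ, ψ (1 + (k + 1 : ℕ)) - ψ (a + (k + 1 : ℕ)) - κ =
      ψ (1 + k) - ψ (a + k) - κ + ((k : ℂ) + 1)⁻¹ - (a + k)⁻¹ := fun k => by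
    rw [hD]
    ring
  have hE0 : ψ (1 + (0 : ℕ)) - ψ (a + (0 : ℕ)) - κ =
      ∑' m : ℕ, (((m : ℂ) + 1 + -a)⁻¹ - ((m : ℂ) + 1)⁻¹) := by
    rw [← digamma_one_sub_digamma_one_add (by simpa using hre), hκ, ← digamma_one_sub_sub_digamma ha,
      hψ, hψ, Nat.cast_zero, add_zero, add_zero, ← sub_eq_add_neg]
    ring
  have hd : 1 < (1 - a).re := by
    rw [Complex.sub_re, Complex.one_re]
    linarith
  have h1a : (1 : ℂ) - a ≠ 0 := fun h => by rw [h] at hd; norm_num at hd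
  have h2a : (1 : ℂ) - a + 1 = 2 - a := by ring
  have hterm : ∀ k : ℕ, (-1 : ℂ) ^ k * (k.factorial : ℂ) / rf (1 - a) (k + 1) =
      (1 / (1 - a)) * ((-1 : ℂ) ^ k * (k.factorial : ℂ) / rf (2 - a) k) := fun k => by
    rw [rf_succ', h2a]
    field_simp
  have hS2 := summable_alternating_factorial_div_rf hd
  have hform : ∀ k : ℕ, rf a k * (-1 : ℂ) ^ k / (k.factorial : ℂ) * (ψ (1 + k) - ψ (a + k)) =
      (-1 : ℂ) ^ k * (rf a k / (k.factorial : ℂ)) * (ψ (1 + k) - ψ (a + k) - κ) +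
        κ * ((-1 : ℂ) ^ k * (rf a k / (k.factorial : ℂ))) := fun k => by ring
  have hs1 := (summable_norm_binomial_mul ha' hre
    (E := fun k : ℕ => ψ (1 + k) - ψ (a + k) - κ) hE).of_norm
  have hs2 : Summable fun k : ℕ => (-1 : ℂ) ^ k * (rf a k / (k.factorial : ℂ)) :=
    Summable.of_norm_bounded (summable_norm_rf_div_factorial ha' hre) fun k => by simp
  refine ⟨(hs1.add (hs2.mul_left κ)).congr fun k => (hform k).symm, ?_, ?_⟩
  · refine (hS2.mul_left (1 - a)).congr fun k => ?_
    rw [hterm]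
    field_simp
  · have hbin := tsum_binomial_eq ha' hre (x := 1) (by simp)
    simp only [Complex.ofReal_one, one_pow, mul_one] at hbin
    have hlog2 : (Real.log (1 + 1) : ℂ) = Complex.log 2 := by
      rw [Complex.ofReal_log (by norm_num)]
      norm_num
    have hpow : ∑' k : ℕ, (-1 : ℂ) ^ k * (rf a k / (k.factorial : ℂ)) =
        Complex.exp (-a * Complex.log 2) := by
      rw [neg_mul, Complex.exp_neg, ← hlog2]
      exact eq_inv_of_mul_eq_one_right hbin
    have hSy : Summable fun k : ℕ => ((k : ℂ) - a)⁻¹ * (1 / 2 : ℂ) ^ k := by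
      have := summable_mul_pow (norm_inv_natCast_sub_le hre) (x := 1 / 2)
        (by rw [abs_of_pos] <;> norm_num)
      simpa using this
    have hshift : ∀ m : ℕ, (((m + 1 : ℕ) : ℂ) - a)⁻¹ * (1 / 2 : ℂ) ^ (m + 1) =
        (1 / 2 : ℂ) ^ (m + 1) / (1 - a + m) := fun m => by
      rw [div_eq_mul_inv _ (1 - a + (m : ℂ)), mul_comm]
      push_cast
      ring_nf
    have heul := tsum_factorial_div_rf_eq hd
      (((summable_nat_add_iff 1).2 hSy).congr hshift)
    have hmain := tsum_binomial_mul_eq ha' hre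
      (E := fun k : ℕ => ψ (1 + k) - ψ (a + k) - κ) hE hE0
    rw [hSy.tsum_eq_zero_add, tsum_congr hshift, ← heul, tsum_congr hterm, tsum_mul_left] at hmain
    rw [tsum_congr hform, hs1.tsum_add (hs2.mul_left κ), tsum_mul_left, hpow, hmain]
    simp only [Nat.cast_zero, zero_sub, pow_zero, mul_one, inv_neg]
    ring
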